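/- arXiv:1605.02956 — 6 statements merged into one kernel-verified Lean document; each statement's English description precedes it below -/
import Mathlib

section
/- For every finite simple graph G without isolated vertices, the induced matching number of the subdivision graph of G satisfies im(S(G)) = |V(G)| − γ(G). -/
/-- The subdivision graph `S(G)` of `G`: the bipartite graph on `V(G) ⊔ E(G)` where
`v : V(G)` is adjacent to `e : E(G)` iff `v` is an endpoint of `e`. -/
def subdiv {V : Type*} (G : SimpleGraph V) : SimpleGraph (V ⊕ G.edgeSet) :=
  SimpleGraph.fromRel (fun a b =>
    ∃ (v : V) (e : G.edgeSet), a = Sum.inl v ∧ b = Sum.inr e ∧ v ∈ (e : Sym2 V))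

/-- `M` is an induced matching of the graph `H`: a set of pairwise disjoint edges such
that every edge of `H` whose endpoints all meet edges of `M` belongs to `M`. -/
def IsInducedMatching {W : Type*} (H : SimpleGraph W) (M : Set (Sym2 W)) : Prop :=
  M ⊆ H.edgeSet ∧
  (M.Pairwise fun e f => ∀ x, x ∈ e → x ∉ f) ∧
  (∀ e ∈ H.edgeSet, (∀ x ∈ e, ∃ f ∈ M, x ∈ f) → e ∈ M)

/-- The induced matching number `im(H)`: the maximum size of an induced matching of `H`. -/
noncomputable def inducedMatchingNum {W : Type*} (H : SimpleGraph W) : ℕ :=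
  sSup {n | ∃ M : Set (Sym2 W), IsInducedMatching H M ∧ M.ncard = n}

/-- `D` is a dominating set of `G`. -/
def IsDomSet {V : Type*} (G : SimpleGraph V) (D : Set V) : Prop :=
  ∀ v, v ∈ D ∨ ∃ d ∈ D, G.Adj d v

/-- The domination number `γ(G)`: the minimum size of a dominating set of `G`. -/
noncomputable def domNum {V : Type*} (G : SimpleGraph V) : ℕ :=
  sInf {n | ∃ D : Set V, IsDomSet G D ∧ D.ncard = n}

theorem mem_edgeSet_subdiv {V : Type*} {G : SimpleGraph V} {f : Sym2 (V ⊕ G.edgeSet)} :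
    f ∈ (subdiv G).edgeSet ↔
      ∃ (v : V) (e : G.edgeSet), v ∈ (e : Sym2 V) ∧ f = s(Sum.inl v, Sum.inr e) := by
  induction f using Sym2.ind with
  | _ a b =>
    rw [SimpleGraph.mem_edgeSet, subdiv, SimpleGraph.fromRel_adj]
    constructor
    · rintro ⟨-, ⟨v, e, rfl, rfl, h⟩ | ⟨v, e, rfl, rfl, h⟩⟩
      · exact ⟨v, e, h, rfl⟩
      · exact ⟨v, e, h, Sym2.eq_swap⟩
    · rintro ⟨v, e, h, hf⟩
      rcases Sym2.eq_iff.1 hf with ⟨rfl, rfl⟩ | ⟨rfl, rfl⟩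
      · exact ⟨by simp, Or.inl ⟨v, e, rfl, rfl, h⟩⟩
      · exact ⟨by simp, Or.inr ⟨v, e, rfl, rfl, h⟩⟩

/-- The vertices of `G` missed by an induced matching of `S(G)` form a dominating set. -/
theorem IsInducedMatching.isDomSet {V : Type*} {G : SimpleGraph V}
    {M : Set (Sym2 (V ⊕ G.edgeSet))} (hM : IsInducedMatching (subdiv G) M) :
    IsDomSet G {v | ∃ f ∈ M, Sum.inl v ∈ f}ᶜ := by
  obtain ⟨hsub, hdisj, hind⟩ := hM
  intro v
  by_cases hv : ∃ f ∈ M, Sum.inl v ∈ f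
  · right
    obtain ⟨f, hf, hvf⟩ := hv
    obtain ⟨v', e, hve, rfl⟩ := mem_edgeSet_subdiv.1 (hsub hf)
    obtain rfl : v = v' := by simpa using hvf
    obtain ⟨w, hw⟩ := Sym2.mem_iff_exists.1 hve
    have hadj : G.Adj v w := by
      rw [← SimpleGraph.mem_edgeSet, ← hw]
      exact e.2
    refine ⟨w, ?_, hadj.symm⟩
    rintro ⟨g, hg, hwg⟩
    have hwe : w ∈ (e : Sym2 V) := by simp [hw]
    have hmem : s(Sum.inl w, Sum.inr e) ∈ M := by
      refine hind _ (mem_edgeSet_subdiv.2 ⟨w, e, hwe, rfl⟩) fun x hx => ?_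
      rcases Sym2.mem_iff.1 hx with rfl | rfl
      · exact ⟨g, hg, hwg⟩
      · exact ⟨_, hf, by simp⟩
    refine hdisj hf hmem (fun h => hadj.ne ?_) (Sum.inr e) (by simp) (by simp)
    simpa using h
  · exact Or.inl hv

/-- An induced matching of `S(G)` has at most as many edges as it covers vertices of `G`. -/
theorem IsInducedMatching.ncard_le {V : Type*} [Finite V] {G : SimpleGraph V}
    {M : Set (Sym2 (V ⊕ G.edgeSet))} (hM : IsInducedMatching (subdiv G) M) :
    M.ncard ≤ {v | ∃ f ∈ M, Sum.inl v ∈ f}.ncard := by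
  obtain ⟨hsub, hdisj, -⟩ := hM
  have hex : ∀ f : M, ∃ v : V, Sum.inl v ∈ f.1 := fun f => by
    obtain ⟨v, e, -, h⟩ := mem_edgeSet_subdiv.1 (hsub f.2)
    exact ⟨v, by simp [h]⟩
  choose φ hφ using hex
  rw [← Nat.card_coe_set_eq, ← Nat.card_coe_set_eq]
  refine Nat.card_le_card_of_injective
    (fun f => (⟨φ f, f, f.2, hφ f⟩ : {v | ∃ f ∈ M, Sum.inl v ∈ f})) fun f g h => ?_
  have hfg : φ f = φ g := congrArg Subtype.val h
  by_contra hne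
  exact hdisj f.2 g.2 (fun h => hne (Subtype.ext h)) _ (hφ f) (hfg ▸ hφ g)

/-- A dominating set `D` yields an induced matching of `S(G)` with one edge for each vertex
outside `D`. -/
theorem IsDomSet.exists_isInducedMatching {V : Type*} {G : SimpleGraph V} {D : Set V}
    (hD : IsDomSet G D) :
    ∃ M : Set (Sym2 (V ⊕ G.edgeSet)), IsInducedMatching (subdiv G) M ∧ M.ncard = Dᶜ.ncard := by
  have hex : ∀ v : (Dᶜ : Set V), ∃ d ∈ D, G.Adj d v := fun v => (hD v).resolve_left v.2
  choose d hdD hadj using hex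
  let e : (Dᶜ : Set V) → G.edgeSet := fun v => ⟨s(d v, v), hadj v⟩
  let F : (Dᶜ : Set V) → Sym2 (V ⊕ G.edgeSet) := fun v => s(Sum.inl v.1, Sum.inr (e v))
  have hmem : ∀ {u v : (Dᶜ : Set V)}, u.1 ∈ (e v).1 → u = v := by
    intro u v h
    rcases Sym2.mem_iff.1 h with h | h
    · exact absurd (h ▸ hdD v) u.2
    · exact Subtype.ext h
  have hF : Function.Injective F := fun u v h => by
    have : u.1 = v.1 ∧ e u = e v := by simpa [F] using h
    exact Subtype.ext this.1
  refine ⟨Set.range F, ⟨?_, ?_, ?_⟩, ?_⟩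
  · rintro _ ⟨v, rfl⟩
    exact mem_edgeSet_subdiv.2 ⟨v, e v, by simp [e], rfl⟩
  · rintro _ ⟨u, rfl⟩ _ ⟨v, rfl⟩ hne x hxu hxv
    apply hne
    congr 1
    rcases Sym2.mem_iff.1 hxu with rfl | rfl
    · exact Subtype.ext (by simpa [F] using hxv)
    · have h : e u = e v := by simpa [F] using hxv
      exact hmem (h ▸ by simp [e])
  · intro f hf hcov
    obtain ⟨v, a, hva, rfl⟩ := mem_edgeSet_subdiv.1 hf
    obtain ⟨_, ⟨u, rfl⟩, hu⟩ := hcov (Sum.inl v) (by simp)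
    obtain ⟨_, ⟨w, rfl⟩, hw⟩ := hcov (Sum.inr a) (by simp)
    obtain rfl : v = u := by simpa [F] using hu
    obtain rfl : a = e w := by simpa [F] using hw
    obtain rfl := hmem hva
    exact ⟨u, rfl⟩
  · rw [← Set.image_univ, Set.ncard_image_of_injective _ hF, Set.ncard_univ,
      Nat.card_coe_set_eq]

/-- For every finite simple graph `G` without isolated vertices,
`im(S(G)) = |V(G)| − γ(G)`. -/
theorem stmt1 {V : Type*} [Fintype V] (G : SimpleGraph V)
    (hiso : ∀ v : V, ∃ u, G.Adj v u) :
    inducedMatchingNum (subdiv G) = Fintype.card V - domNum G := by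
  have hne : {n | ∃ D : Set V, IsDomSet G D ∧ D.ncard = n}.Nonempty :=
    ⟨_, Set.univ, fun v => Or.inl (Set.mem_univ v), rfl⟩
  have hcompl : ∀ D : Set V, D.ncard + Dᶜ.ncard = Fintype.card V := fun D => by
    rw [Set.ncard_add_ncard_compl, Nat.card_eq_fintype_card]
  refine IsGreatest.csSup_eq ⟨?_, ?_⟩
  · obtain ⟨D, hD, hcard⟩ := Nat.sInf_mem hne
    obtain ⟨M, hM, hMcard⟩ := hD.exists_isInducedMatching
    refine ⟨M, hM, ?_⟩
    have h := hcompl D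
    rw [domNum]
    omega
  · rintro _ ⟨M, hM, rfl⟩
    have hγ : domNum G ≤ _ := Nat.sInf_le ⟨_, hM.isDomSet, rfl⟩
    have hle := hM.ncard_le
    have h := hcompl {v | ∃ f ∈ M, Sum.inl v ∈ f}
    omega
end

section
/- For every finite simple graph G without isolated vertices and with at least one edge, the flower number of the Alexander dual of the independence complex of G satisfies ν(Ind(G)^∨) = |V(G)| − γ_us(G). -/
/-- `A` is an independent set of `G`. -/
def IsIndepSet' {V : Type*} (G : SimpleGraph V) (A : Set V) : Prop :=
  ∀ x ∈ A, ∀ y ∈ A, ¬ G.Adj x y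

/-- The independence complex `Ind(G)`: faces are the independent sets of `G`. -/
def indComplex {V : Type*} (G : SimpleGraph V) : Set (Set V) :=
  {S | IsIndepSet' G S}

/-- The Alexander dual `Δ^∨ = {F ⊆ V : V ∖ F ∉ Δ}` of a (generalized) simplicial
complex `Δ`. -/
def alexDual {V : Type*} (Δ : Set (Set V)) : Set (Set V) :=
  {F | Fᶜ ∉ Δ}

/-- `F` is a facet (maximal face) of the (generalized) simplicial complex `Δ`. -/
def IsFacet {V : Type*} (Δ : Set (Set V)) (F : Set V) : Prop :=
  F ∈ Δ ∧ ∀ F' ∈ Δ, F ⊆ F' → F = F'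

/-- `Δ` has an `m`-flower: pairs `(x 1, F 1), …, (x m, F m)` of vertices and facets
such that `{x 1, …, x m}` is a face of `Δ` and `x i ∉ F j ↔ i = j`. -/
def HasFlower {V : Type*} (Δ : Set (Set V)) (m : ℕ) : Prop :=
  ∃ (x : Fin m → V) (F : Fin m → Set V),
    Set.range x ∈ Δ ∧ (∀ i, IsFacet Δ (F i)) ∧ ∀ i j, x i ∉ F j ↔ i = j

/-- The flower number `ν(Δ)`: the maximum `m ≥ 1` for which `Δ` has an `m`-flower,
and `0` if `Δ` has no flower. -/
noncomputable def flowerNum {V : Type*} (Δ : Set (Set V)) : ℕ :=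
  sSup {m | 1 ≤ m ∧ HasFlower Δ m}

/-- The unstable domination number `γ_us(G)`: the minimum size of a dominating set `X`
such that the induced subgraph `G[X]` contains at least one edge. -/
noncomputable def unstableDomNum {V : Type*} (G : SimpleGraph V) : ℕ :=
  sInf {n | ∃ X : Set V, IsDomSet G X ∧ (∃ x ∈ X, ∃ y ∈ X, G.Adj x y) ∧ X.ncard = n}

theorem mem_alexDual_indComplex {V : Type*} (G : SimpleGraph V) (F : Set V) :
    F ∈ alexDual (indComplex G) ↔ ∃ x ∈ Fᶜ, ∃ y ∈ Fᶜ, G.Adj x y := by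
  simp only [alexDual, indComplex, IsIndepSet', Set.mem_ofPred_eq]
  push Not
  rfl

/-- The facets of the Alexander dual of `Ind(G)` are the complements of the edges of `G`. -/
theorem isFacet_alexDual_indComplex_iff {V : Type*} (G : SimpleGraph V) (F : Set V) :
    IsFacet (alexDual (indComplex G)) F ↔ ∃ u v, G.Adj u v ∧ F = {u, v}ᶜ := by
  constructor
  · rintro ⟨hF, hmax⟩
    obtain ⟨u, hu, v, hv, huv⟩ := (mem_alexDual_indComplex G F).1 hF
    refine ⟨u, v, huv, hmax _ ?_ ?_⟩
    · exact (mem_alexDual_indComplex G _).2 ⟨u, by simp, v, by simp, huv⟩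
    · rintro w hw (rfl | rfl)
      · exact hu hw
      · exact hv hw
  · rintro ⟨u, v, huv, rfl⟩
    refine ⟨(mem_alexDual_indComplex G _).2 ⟨u, by simp, v, by simp, huv⟩, fun F' hF' hsub => ?_⟩
    obtain ⟨a, ha, b, hb, hab⟩ := (mem_alexDual_indComplex G F').1 hF'
    have hsub' : F'ᶜ ⊆ {u, v} := Set.compl_subset_comm.1 hsub
    have hne := hab.ne
    refine hsub.antisymm fun w hw hw' => ?_
    have ha' := hsub' ha
    have hb' := hsub' hb
    simp only [Set.mem_insert_iff, Set.mem_singleton_iff, Set.mem_compl_iff] at ha hb ha' hb' hw'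
    grind

/-- Flowers of the Alexander dual of `Ind(G)` correspond to complements of unstable
dominating sets of `G`. -/
theorem hasFlower_alexDual_indComplex_iff {V : Type*} [Fintype V] (G : SimpleGraph V) (m : ℕ) :
    HasFlower (alexDual (indComplex G)) m ↔
      ∃ X : Set V, IsDomSet G X ∧ (∃ x ∈ X, ∃ y ∈ X, G.Adj x y) ∧
        X.ncard + m = Fintype.card V := by
  constructor
  · rintro ⟨x, F, hx, hF, hxF⟩
    have hinj : Function.Injective x := fun i j hij =>
      (hxF i j).1 (hij ▸ (hxF j j).2 rfl)
    refine ⟨(Set.range x)ᶜ, fun w => ?_, (mem_alexDual_indComplex G _).1 hx, ?_⟩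
    · by_cases hw : w ∈ Set.range x
      · obtain ⟨i, rfl⟩ := hw
        obtain ⟨u, v, huv, hFi⟩ := (isFacet_alexDual_indComplex_iff G _).1 (hF i)
        have key : ∀ j, (x j = u ∨ x j = v) ↔ j = i := fun j => by
          simpa [hFi, or_iff_not_imp_left] using hxF j i
        right
        rcases (key i).2 rfl with h | h
        · refine ⟨v, ?_, h ▸ huv.symm⟩
          rintro ⟨j, hj⟩
          have := (key j).1 (Or.inr hj)
          subst this
          exact huv.ne (h.symm.trans hj)
        · refine ⟨u, ?_, h ▸ huv⟩
          rintro ⟨j, hj⟩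
          have := (key j).1 (Or.inl hj)
          subst this
          exact huv.ne (hj.symm.trans h)
      · exact Or.inl hw
    · have h := Set.ncard_add_ncard_compl (Set.range x)
      rw [← Set.image_univ, Set.ncard_image_of_injective _ hinj, Set.ncard_univ,
        Nat.card_eq_fintype_card, Nat.card_eq_fintype_card, Fintype.card_fin,
        Set.image_univ] at h
      omega
  · rintro ⟨X, hdom, hedge, hcard⟩
    have hc := Set.ncard_add_ncard_compl X
    rw [Nat.card_eq_fintype_card] at hc
    have hm : Nat.card (Xᶜ : Set V) = m := by
      rw [Nat.card_coe_set_eq]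
      omega
    let e : Fin m ≃ (Xᶜ : Set V) := (Finite.equivFinOfCardEq hm).symm
    have hd : ∀ i, ∃ d ∈ X, G.Adj d (e i) := fun i =>
      (hdom (e i)).resolve_left (e i).2
    choose d hdX hd using hd
    refine ⟨fun i => e i, fun i => {d i, (e i : V)}ᶜ, ?_, fun i => ?_, fun i j => ?_⟩
    · have hr : Set.range (fun i => (e i : V)) = Xᶜ := by
        rw [show (fun i => (e i : V)) = Subtype.val ∘ e from rfl, e.surjective.range_comp,
          Subtype.range_coe]
      rw [hr, mem_alexDual_indComplex, compl_compl]
      exact hedge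
    · exact (isFacet_alexDual_indComplex_iff G _).2 ⟨_, _, hd i, rfl⟩
    · have hne : (e i : V) ≠ d j := fun h => (e i).2 (h ▸ hdX j)
      simp [hne, Subtype.val_inj]

/-- For every finite simple graph `G` without isolated vertices and with at least one
edge, `ν(Ind(G)^∨) = |V(G)| − γ_us(G)`. -/
theorem stmt2 {V : Type*} [Fintype V] (G : SimpleGraph V)
    (hiso : ∀ v : V, ∃ u, G.Adj v u) (hedge : G.edgeSet.Nonempty) :
    flowerNum (alexDual (indComplex G)) = Fintype.card V - unstableDomNum G := by
  obtain ⟨ed, hed⟩ := hedge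
  induction ed with | _ u v =>
  have hne : {n | ∃ X : Set V, IsDomSet G X ∧ (∃ x ∈ X, ∃ y ∈ X, G.Adj x y) ∧
      X.ncard = n}.Nonempty :=
    ⟨_, Set.univ, fun w => Or.inl trivial, ⟨u, trivial, v, trivial, hed⟩, rfl⟩
  obtain ⟨X, hdom, hX, hcard⟩ : ∃ X : Set V, IsDomSet G X ∧
      (∃ x ∈ X, ∃ y ∈ X, G.Adj x y) ∧ X.ncard = unstableDomNum G := Nat.sInf_mem hne
  have hle : X.ncard ≤ Fintype.card V := by
    simpa only [Nat.card_eq_fintype_card] using Set.ncard_le_card X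
  have hub : ∀ m ∈ {m | 1 ≤ m ∧ HasFlower (alexDual (indComplex G)) m},
      m ≤ Fintype.card V - unstableDomNum G := by
    rintro m ⟨-, hm⟩
    obtain ⟨Y, hYdom, hY, hYcard⟩ := (hasFlower_alexDual_indComplex_iff G m).1 hm
    have : unstableDomNum G ≤ Y.ncard := Nat.sInf_le ⟨Y, hYdom, hY, rfl⟩
    omega
  refine le_antisymm (csSup_le' hub) ?_
  rcases Nat.eq_zero_or_pos (Fintype.card V - unstableDomNum G) with h0 | hpos
  · exact h0 ▸ Nat.zero_le _
  · exact le_csSup ⟨_, hub⟩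
      ⟨hpos, (hasFlower_alexDual_indComplex_iff G _).2 ⟨X, hdom, hX, by omega⟩⟩
end

section
/- If {F_1, …, F_k} is an induced matching of a simple hypergraph H, then Σ_{i=1}^k (|F_i| − 1) ≤ im(B(H)). -/
/-- `S` is an independent set of the hypergraph with edge set `E`: it contains no edge. -/
def HIndep {V : Type*} (E : Set (Set V)) (S : Set V) : Prop :=
  ∀ e ∈ E, ¬ e ⊆ S

/-- `S` is a maximal independent set of the hypergraph with edge set `E`. -/
def MaxHIndep {V : Type*} (E : Set (Set V)) (S : Set V) : Prop :=
  HIndep E S ∧ ∀ T : Set V, HIndep E T → S ⊆ T → S = T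

/-- The bipartite graph `B(H)` on `V ⊔ M`, where `M` is the set of maximal independent
sets of the hypergraph `H = (V, E)` and `v : V` is adjacent to `S ∈ M` iff `v ∉ S`. -/
def hypFacetGraph {V : Type*} (E : Set (Set V)) :
    SimpleGraph (V ⊕ {S : Set V // MaxHIndep E S}) :=
  SimpleGraph.fromRel (fun a b =>
    ∃ (v : V) (S : {S : Set V // MaxHIndep E S}), a = Sum.inl v ∧ b = Sum.inr S ∧ v ∉ S.1)

theorem hypFacetGraph_adj_inl_inr {V : Type*} {E : Set (Set V)} {v : V}
    {S : {S : Set V // MaxHIndep E S}} :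
    (hypFacetGraph E).Adj (Sum.inl v) (Sum.inr S) ↔ v ∉ S.1 := by
  simp [hypFacetGraph]

theorem HIndep.exists_maxHIndep_superset {V : Type*} [Finite V] {E : Set (Set V)} {U : Set V}
    (hU : HIndep E U) : ∃ S, MaxHIndep E S ∧ U ⊆ S := by
  obtain ⟨S, hUS, hS⟩ := (Set.toFinite {T : Set V | HIndep E T}).exists_le_maximal hU
  exact ⟨S, ⟨hS.prop, fun T hT hST => hS.eq_of_le hT hST⟩, hUS⟩

theorem IsInducedMatching.ncard_le_inducedMatchingNum {W : Type*} [Finite W] {H : SimpleGraph W}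
    {M : Set (Sym2 W)} (hM : IsInducedMatching H M) : M.ncard ≤ inducedMatchingNum H := by
  refine le_csSup ⟨Nat.card (Sym2 W), ?_⟩ ⟨M, hM, rfl⟩
  rintro n ⟨N, -, rfl⟩
  exact Set.ncard_le_card N

/-- A family of maximal independent sets `g v`, one for each vertex `v` of `W`, with
`W \ g v = {v}` yields an induced matching of `B(H)` of size `|W|`. -/
theorem ncard_le_inducedMatchingNum_hypFacetGraph {V : Type*} [Finite V] {E : Set (Set V)}
    {W : Set V} (g : V → {S : Set V // MaxHIndep E S})
    (hg : ∀ v ∈ W, ∀ w ∈ W, w ∉ (g v).1 ↔ w = v) :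
    W.ncard ≤ inducedMatchingNum (hypFacetGraph E) := by
  have hginj : ∀ v ∈ W, ∀ w ∈ W, g v = g w → v = w := fun v hv w hw h =>
    (hg w hw v hv).1 (h ▸ (hg v hv v hv).2 rfl)
  let m : V → Sym2 (V ⊕ {S : Set V // MaxHIndep E S}) := fun v => s(Sum.inl v, Sum.inr (g v))
  have hm : Function.Injective m := fun v w h => by
    simp only [m, Sym2.eq_iff, Sum.inl.injEq, reduceCtorEq, and_self, or_false] at h
    exact h.1
  rw [← Set.ncard_image_of_injective W hm]
  refine IsInducedMatching.ncard_le_inducedMatchingNum ⟨?_, ?_, ?_⟩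
  · rintro _ ⟨v, hv, rfl⟩
    exact hypFacetGraph_adj_inl_inr.2 ((hg v hv v hv).2 rfl)
  · rintro _ ⟨v, hv, rfl⟩ _ ⟨w, hw, rfl⟩ hne x hx hx'
    have hvw : v ≠ w := fun h => hne (h ▸ rfl)
    simp only [m, Sym2.mem_iff] at hx hx'
    rcases hx with rfl | rfl <;> rcases hx' with h | h
    · exact hvw (Sum.inl_injective h)
    · cases h
    · cases h
    · exact hvw (hginj v hv w hw (Sum.inr_injective h))
  · have key : ∀ v S, (hypFacetGraph E).Adj (Sum.inl v) (Sum.inr S) →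
        (∃ f ∈ m '' W, Sum.inl v ∈ f) → (∃ f ∈ m '' W, Sum.inr S ∈ f) →
        s(Sum.inl v, Sum.inr S) ∈ m '' W := by
      rintro v S hadj ⟨_, ⟨a, ha, rfl⟩, hva⟩ ⟨_, ⟨b, hb, rfl⟩, hSb⟩
      simp only [m, Sym2.mem_iff, Sum.inl.injEq, Sum.inr.injEq, reduceCtorEq, or_false,
        false_or] at hva hSb
      subst hva hSb
      obtain rfl := (hg b hb v ha).1 (hypFacetGraph_adj_inl_inr.1 hadj)
      exact ⟨v, ha, rfl⟩
    intro e
    induction e using Sym2.ind with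
    | _ x y =>
      intro he hcov
      have hx := hcov x (Sym2.mem_mk_left x y)
      have hy := hcov y (Sym2.mem_mk_right x y)
      rw [SimpleGraph.mem_edgeSet] at he
      rcases x with v | S <;> rcases y with w | T
      · simp [hypFacetGraph] at he
      · exact key v T he hx hy
      · rw [Sym2.eq_swap]
        exact key w S he.symm hy hx
      · simp [hypFacetGraph] at he

/-- If `{F 1, …, F k}` is an induced matching of a simple hypergraph `H = (V, E)`
(each edge has at least two vertices, and no edge contains another), then
`Σ_{i=1}^k (|F i| − 1) ≤ im(B(H))`. -/
theorem stmt6 {V : Type*} [Fintype V] (E : Set (Set V))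
    (hcard : ∀ e ∈ E, 2 ≤ e.ncard)
    (hanti : ∀ e ∈ E, ∀ f ∈ E, e ⊆ f → e = f)
    (k : ℕ) (F : Fin k → Set V)
    (hFE : ∀ i, F i ∈ E)
    (hdisj : ∀ i j, i ≠ j → Disjoint (F i) (F j))
    (hindmat : ∀ e ∈ E, e ⊆ (⋃ i, F i) → ∃ i, e = F i) :
    (∑ i, ((F i).ncard - 1)) ≤ inducedMatchingNum (hypFacetGraph E) := by
  choose a ha using fun i =>
    Set.nonempty_of_ncard_ne_zero (by have := hcard _ (hFE i); omega : (F i).ncard ≠ 0)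
  have huniq : ∀ {i j x}, x ∈ F i → x ∈ F j → i = j := fun {i j x} hi hj =>
    by_contra fun h => Set.disjoint_left.1 (hdisj i j h) hi hj
  have hex : ∀ v ∈ ⋃ i, F i \ {a i}, ∃ S : {S : Set V // MaxHIndep E S},
      ∀ w ∈ ⋃ i, F i \ {a i}, w ∉ S.1 ↔ w = v := by
    intro v hv
    obtain ⟨i, hvi, hva⟩ := Set.mem_iUnion.1 hv
    have hU : HIndep E (insert (a i) (⋃ j, F j \ {a j}) \ {v}) := by
      intro e he hsub
      obtain ⟨j, rfl⟩ := hindmat e he fun x hx => by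
        rcases (hsub hx).1 with rfl | h
        · exact Set.mem_iUnion.2 ⟨i, ha i⟩
        · exact Set.iUnion_mono (fun _ => Set.sdiff_subset) h
      by_cases hij : j = i
      · subst hij
        exact (hsub hvi).2 rfl
      · rcases (hsub (ha j)).1 with h | h
        · exact hij (huniq (ha j) (h ▸ ha i))
        · obtain ⟨l, hl, hne⟩ := Set.mem_iUnion.1 h
          obtain rfl := huniq (ha j) hl
          exact hne rfl
    obtain ⟨S, hS, hUS⟩ := hU.exists_maxHIndep_superset
    refine ⟨⟨S, hS⟩, fun w hw => ⟨fun h => ?_, ?_⟩⟩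
    · by_contra hne
      exact h (hUS ⟨Or.inr hw, hne⟩)
    · rintro rfl hwS
      refine hS.1 (F i) (hFE i) fun x hx => ?_
      by_cases hxw : x = w
      · exact hxw ▸ hwS
      · refine hUS ⟨?_, hxw⟩
        by_cases hxa : x = a i
        · exact Or.inl hxa
        · exact Or.inr (Set.mem_iUnion.2 ⟨i, hx, hxa⟩)
  have hsum : ∑ i, ((F i).ncard - 1) = (⋃ i, F i \ {a i}).ncard := by
    rw [Set.ncard_iUnion_of_finite (fun _ => Set.toFinite _)
      (fun i j hij => (hdisj i j hij).mono Set.sdiff_subset Set.sdiff_subset),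
      finsum_eq_sum_of_fintype]
    exact Finset.sum_congr rfl fun i _ => (Set.ncard_sdiff_singleton_of_mem (ha i)).symm
  obtain ⟨S₀, hS₀, -⟩ := HIndep.exists_maxHIndep_superset (E := E) (U := ∅) fun e he hsub => by
    have := hcard e he
    simp [Set.subset_empty_iff.1 hsub] at this
  have : Nonempty {S : Set V // MaxHIndep E S} := ⟨⟨S₀, hS₀⟩⟩
  choose! g hg using fun v (hv : v ∈ ⋃ i, F i \ {a i}) => hex v hv
  rw [hsum]
  exact ncard_le_inducedMatchingNum_hypFacetGraph g hg
end

section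
/- Let G be a finite simple graph. An independent set L ⊆ V(G) is a minimal S-face of the independence complex Ind(G) if and only if L is a minimal vertex-wise dominating set of G. -/
/-- The link `lk_Δ(A) = {F ∈ Δ : F ∩ A = ∅ and F ∪ A ∈ Δ}` of a face `A` in `Δ`. -/
def link {V : Type*} (Δ : Set (Set V)) (A : Set V) : Set (Set V) :=
  {F | F ∈ Δ ∧ F ∩ A = ∅ ∧ F ∪ A ∈ Δ}

/-- `A` is an `S`-face of `Δ`: `A` is a face whose link is a simplex, i.e. the union
of all faces of the link is itself a face of the link. -/
def IsSFace {V : Type*} (Δ : Set (Set V)) (A : Set V) : Prop :=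
  A ∈ Δ ∧ ⋃₀ (link Δ A) ∈ link Δ A

/-- `A` is a minimal `S`-face of `Δ`: no proper subset of `A` is an `S`-face. -/
def IsMinSFace {V : Type*} (Δ : Set (Set V)) (A : Set V) : Prop :=
  IsSFace Δ A ∧ ∀ B ⊂ A, ¬ IsSFace Δ B

/-- The vertex `u` vertex-wise dominates the edge `e` in `G`: `u` belongs to the closed
neighbourhood of the set of endpoints of `e`. -/
def VWDominates {V : Type*} (G : SimpleGraph V) (u : V) (e : Sym2 V) : Prop :=
  ∃ x ∈ e, u = x ∨ G.Adj u x

/-- `S` is a vertex-wise dominating set of `G`. -/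
def IsVWDomSet {V : Type*} (G : SimpleGraph V) (S : Set V) : Prop :=
  ∀ e ∈ G.edgeSet, ∃ u ∈ S, VWDominates G u e

/-- `S` is a minimal vertex-wise dominating set of `G`. -/
def IsMinVWDomSet {V : Type*} (G : SimpleGraph V) (S : Set V) : Prop :=
  IsVWDomSet G S ∧ ∀ T ⊂ S, ¬ IsVWDomSet G T

theorem mem_sUnion_link_indComplex {V : Type*} (G : SimpleGraph V) {A : Set V}
    (hA : IsIndepSet' G A) (v : V) :
    v ∈ ⋃₀ link (indComplex G) A ↔ v ∉ A ∧ ∀ a ∈ A, ¬ G.Adj a v := by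
  constructor
  · rintro ⟨F, ⟨-, hdisj, hF⟩, hv⟩
    refine ⟨fun hvA => ?_, fun a ha => hF a (.inr ha) v (.inl hv)⟩
    have : v ∈ F ∩ A := ⟨hv, hvA⟩
    simp [hdisj] at this
  · rintro ⟨hvA, hadj⟩
    refine ⟨{v}, ⟨?_, by simpa using hvA, ?_⟩, rfl⟩
    · rintro x rfl y rfl
      exact G.irrefl
    · rintro x (rfl | hx) y (rfl | hy)
      · exact G.irrefl
      · exact fun h => hadj y hy h.symm
      · exact hadj x hx
      · exact hA x hx y hy

/-- The `S`-faces of `Ind(G)` are the independent vertex-wise dominating sets of `G`. -/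
theorem isSFace_indComplex_iff {V : Type*} (G : SimpleGraph V) {A : Set V}
    (hA : IsIndepSet' G A) : IsSFace (indComplex G) A ↔ IsVWDomSet G A := by
  have hmem := mem_sUnion_link_indComplex G hA
  constructor
  · rintro ⟨-, hU, -, -⟩ e he
    induction e with | _ x y
    by_contra! hdom
    have key : ∀ z ∈ s(x, y), z ∈ ⋃₀ link (indComplex G) A := fun z hz =>
      (hmem z).2 ⟨fun hzA => hdom z hzA ⟨z, hz, .inl rfl⟩,
        fun a ha h => hdom a ha ⟨z, hz, .inr h⟩⟩
    exact hU x (key x (by simp)) y (key y (by simp)) he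
  · intro hdom
    have hU : ⋃₀ link (indComplex G) A ∈ indComplex G := by
      intro x hx y hy hxy
      obtain ⟨u, hu, z, hz, h⟩ := hdom s(x, y) hxy
      have hzU : z ∈ ⋃₀ link (indComplex G) A := by
        rcases Sym2.mem_iff.1 hz with rfl | rfl <;> assumption
      rcases h with rfl | h
      · exact ((hmem _).1 hzU).1 hu
      · exact ((hmem z).1 hzU).2 u hu h
    refine ⟨hA, hU, ?_, ?_⟩
    · ext v
      simp only [Set.mem_inter_iff, Set.mem_empty_iff_false, iff_false]
      exact fun hv => ((hmem v).1 hv.1).1 hv.2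
    · rintro x (hx | hx) y (hy | hy)
      · exact hU x hx y hy
      · exact fun h => ((hmem x).1 hx).2 y hy h.symm
      · exact ((hmem y).1 hy).2 x hx
      · exact hA x hx y hy

/-- For a finite simple graph `G`, an independent set `L ⊆ V(G)` is a minimal `S`-face
of `Ind(G)` iff `L` is a minimal vertex-wise dominating set of `G`. -/
theorem stmt9 {V : Type*} [Fintype V] (G : SimpleGraph V) (L : Set V)
    (hL : IsIndepSet' G L) :
    IsMinSFace (indComplex G) L ↔ IsMinVWDomSet G L := by
  refine and_congr (isSFace_indComplex_iff G hL) (forall₂_congr fun B hB => not_congr ?_)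
  exact isSFace_indComplex_iff G fun x hx y hy => hL x (hB.1 hx) y (hB.1 hy)
end

section
/- For every simple hypergraph H = (V,E) in which every vertex lies in some edge, h_E(L(H)) ≤ im(L(H)), where h_E(L(H)) is the least size of a subset S ⊆ E such that every vertex v ∈ V is at distance at most 3 in the Levi graph L(H) from some member of S. -/
/-- The Levi graph `L(H)` of the hypergraph with vertex set `V` and edge set `E`:
the bipartite graph on `V ⊔ E` where `x : V` is adjacent to `e ∈ E` iff `x ∈ e`. -/
def leviGraph {V : Type*} (E : Set (Set V)) :
    SimpleGraph (V ⊕ {e : Set V // e ∈ E}) :=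
  SimpleGraph.fromRel (fun a b =>
    ∃ (x : V) (e : {e : Set V // e ∈ E}), a = Sum.inl x ∧ b = Sum.inr e ∧ x ∈ e.1)

/-- `h_E(L(H))`: the least size of a set `S` of edges of the hypergraph such that every
vertex `v` is at distance at most `3` in the Levi graph from some member of `S`. -/
noncomputable def hEdgeNum {V : Type*} (E : Set (Set V)) : ℕ :=
  sInf {n | ∃ S : Set {e : Set V // e ∈ E},
    (∀ v : V, ∃ e ∈ S, ∃ p : (leviGraph E).Walk (Sum.inr e) (Sum.inl v), p.length ≤ 3) ∧
    S.ncard = n}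

theorem leviGraph_adj_inl_inr {V : Type*} {E : Set (Set V)} {x : V} {e : {e : Set V // e ∈ E}} :
    (leviGraph E).Adj (Sum.inl x) (Sum.inr e) ↔ x ∈ e.1 := by
  simp [leviGraph]

theorem leviGraph_not_adj_inl_inl {V : Type*} {E : Set (Set V)} {x y : V} :
    ¬ (leviGraph E).Adj (Sum.inl x) (Sum.inl y) := by
  simp [leviGraph]

theorem leviGraph_not_adj_inr_inr {V : Type*} {E : Set (Set V)} {e f : {e : Set V // e ∈ E}} :
    ¬ (leviGraph E).Adj (Sum.inr e) (Sum.inr f) := by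
  simp [leviGraph]

/-- A vertex `v` is within distance `3` of an edge `e` iff some edge through `v` meets `e`. -/
theorem exists_leviGraph_walk_length_le_three_iff {V : Type*} {E : Set (Set V)} {v : V}
    {e : {e : Set V // e ∈ E}} :
    (∃ p : (leviGraph E).Walk (Sum.inr e) (Sum.inl v), p.length ≤ 3) ↔
      ∃ f : {e : Set V // e ∈ E}, v ∈ f.1 ∧ ∃ x ∈ f.1, x ∈ e.1 := by
  constructor
  · rintro ⟨p, hp⟩
    cases p with
    | @cons _ a _ h q =>
      rcases a with x | a
      · have hx := leviGraph_adj_inl_inr.1 h.symm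
        cases q with
        | nil => exact ⟨e, hx, v, hx, hx⟩
        | @cons _ b _ h' r =>
          rcases b with y | f
          · exact absurd h' leviGraph_not_adj_inl_inl
          · have hf := leviGraph_adj_inl_inr.1 h'
            cases r with
            | cons h'' t =>
              simp only [SimpleGraph.Walk.length_cons] at hp
              have ht := SimpleGraph.Walk.eq_of_length_eq_zero (p := t) (by omega)
              subst ht
              exact ⟨f, leviGraph_adj_inl_inr.1 h''.symm, x, hf, hx⟩
      · exact absurd h leviGraph_not_adj_inr_inr
  · rintro ⟨f, hv, x, hxf, hxe⟩
    exact ⟨.cons (leviGraph_adj_inl_inr.2 hxe).symm (.cons (leviGraph_adj_inl_inr.2 hxf)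
      (.cons (leviGraph_adj_inl_inr.2 hv).symm .nil)), by simp⟩

/-- Vertices `w i` and edges `f i` with `w i ∈ f j ↔ i = j` form an induced matching of the
Levi graph. -/
theorem ncard_le_inducedMatchingNum_leviGraph {V ι : Type*} [Finite V] {E : Set (Set V)}
    (S : Set ι) (w : ι → V) (f : ι → {e : Set V // e ∈ E})
    (hwf : ∀ i ∈ S, ∀ j ∈ S, w i ∈ (f j).1 ↔ i = j) :
    S.ncard ≤ inducedMatchingNum (leviGraph E) := by
  let m : ι → Sym2 (V ⊕ {e : Set V // e ∈ E}) := fun i => s(Sum.inl (w i), Sum.inr (f i))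
  have hw : ∀ i ∈ S, ∀ j ∈ S, w i = w j → i = j := fun i hi j hj h =>
    (hwf i hi j hj).1 (h ▸ (hwf j hj j hj).2 rfl)
  have hf : ∀ i ∈ S, ∀ j ∈ S, f i = f j → i = j := fun i hi j hj h =>
    (hwf i hi j hj).1 (h ▸ (hwf i hi i hi).2 rfl)
  have hm : Set.InjOn m S := by
    intro i hi j hj h
    simp only [m, Sym2.eq_iff, Sum.inl.injEq, reduceCtorEq, false_and, or_false] at h
    exact hw i hi j hj h.1
  rw [← hm.ncard_image]
  refine IsInducedMatching.ncard_le_inducedMatchingNum ⟨?_, ?_, ?_⟩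
  · rintro _ ⟨i, hi, rfl⟩
    exact leviGraph_adj_inl_inr.2 ((hwf i hi i hi).2 rfl)
  · rintro _ ⟨i, hi, rfl⟩ _ ⟨j, hj, rfl⟩ hne x hxi hxj
    apply hne
    rcases Sym2.mem_iff.1 hxi with rfl | rfl <;> rcases Sym2.mem_iff.1 hxj with h | h
    · rw [hw i hi j hj (Sum.inl.inj h)]
    · cases h
    · cases h
    · rw [hf i hi j hj (Sum.inr.inj h)]
  · have key : ∀ x e, (leviGraph E).Adj (Sum.inl x) (Sum.inr e) →
        (∃ g ∈ m '' S, Sum.inl x ∈ g) → (∃ g ∈ m '' S, Sum.inr e ∈ g) →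
        s(Sum.inl x, Sum.inr e) ∈ m '' S := by
      rintro x e hadj ⟨_, ⟨i, hi, rfl⟩, hx⟩ ⟨_, ⟨j, hj, rfl⟩, he⟩
      simp only [m, Sym2.mem_iff, Sum.inl.injEq, Sum.inr.injEq, reduceCtorEq, or_false,
        false_or] at hx he
      subst hx he
      obtain rfl := (hwf i hi j hj).1 (leviGraph_adj_inl_inr.1 hadj)
      exact ⟨i, hi, rfl⟩
    intro g
    induction g with
    | _ a b =>
      intro hab hcov
      have hadj : (leviGraph E).Adj a b := hab
      have ha := hcov a (Sym2.mem_mk_left a b)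
      have hb := hcov b (Sym2.mem_mk_right a b)
      rcases a with x | e <;> rcases b with y | e'
      · exact absurd hadj leviGraph_not_adj_inl_inl
      · exact key x e' hadj ha hb
      · rw [Sym2.eq_swap]
        exact key y e hadj.symm hb ha
      · exact absurd hadj leviGraph_not_adj_inr_inr

/-- For every simple hypergraph `H = (V, E)` (each edge has at least two vertices, no
edge contains another) in which every vertex lies in some edge,
`h_E(L(H)) ≤ im(L(H))`. -/
theorem stmt11 {V : Type*} [Fintype V] (E : Set (Set V))
    (hcard : ∀ e ∈ E, 2 ≤ e.ncard)
    (hanti : ∀ e ∈ E, ∀ f ∈ E, e ⊆ f → e = f)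
    (hcover : ∀ v : V, ∃ e ∈ E, v ∈ e) :
    hEdgeNum E ≤ inducedMatchingNum (leviGraph E) := by
  classical
  obtain ⟨S, hS, hcardS⟩ := Nat.sInf_mem (s := {n | ∃ S : Set {e : Set V // e ∈ E},
    (∀ v : V, ∃ e ∈ S, ∃ p : (leviGraph E).Walk (Sum.inr e) (Sum.inl v), p.length ≤ 3) ∧
    S.ncard = n}) (by
      refine ⟨_, Set.univ, fun v => ?_, rfl⟩
      obtain ⟨e, he, hv⟩ := hcover v
      exact ⟨⟨e, he⟩, trivial,
        exists_leviGraph_walk_length_le_three_iff.2 ⟨⟨e, he⟩, hv, v, hv, hv⟩⟩)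
  change S.ncard = hEdgeNum E at hcardS
  simp only [exists_leviGraph_walk_length_le_three_iff] at hS
  -- By minimality of `S`, each `s ∈ S` has a vertex that only `s` dominates.
  have hprivate : ∀ s : {e : Set V // e ∈ E}, ∃ (v : V) (f : {e : Set V // e ∈ E}), s ∈ S →
      (v ∈ f.1 ∧ ∃ x ∈ f.1, x ∈ s.1) ∧
      ∀ t ∈ S, ∀ g : {e : Set V // e ∈ E}, v ∈ g.1 → (∃ x ∈ g.1, x ∈ t.1) → t = s := by
    intro s
    by_cases hs : s ∈ S
    · have hv : ∃ v, ∀ t ∈ S, ∀ g : {e : Set V // e ∈ E}, v ∈ g.1 →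
          (∃ x ∈ g.1, x ∈ t.1) → t = s := by
        by_contra! hcon
        refine (Set.ncard_sdiff_singleton_lt_of_mem hs).not_ge
          (hcardS ▸ Nat.sInf_le ⟨S \ {s}, fun v => ?_, rfl⟩)
        obtain ⟨t, ht, g, hvg, hgt, hts⟩ := hcon v
        exact ⟨t, ⟨ht, hts⟩, exists_leviGraph_walk_length_le_three_iff.2 ⟨g, hvg, hgt⟩⟩
      obtain ⟨v, hv⟩ := hv
      obtain ⟨t, ht, f, hvf, hft⟩ := hS v
      obtain rfl := hv t ht f hvf hft
      exact ⟨v, f, fun _ => ⟨⟨hvf, hft⟩, hv⟩⟩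
    · obtain ⟨x, -⟩ := Set.nonempty_of_ncard_ne_zero
        (by have := hcard s.1 s.2; omega : s.1.ncard ≠ 0)
      exact ⟨x, s, fun h => absurd h hs⟩
  choose w f hwf using hprivate
  rw [← hcardS]
  refine ncard_le_inducedMatchingNum_leviGraph S w f fun s hs t ht => ⟨fun h => ?_, ?_⟩
  · exact ((hwf s hs).2 t ht (f t) h (hwf t ht).1.2).symm
  · rintro rfl
    exact (hwf s hs).1.1
end

section
/- For every simple hypergraph H on a finite vertex set V with at least one edge, the Helly number of the Alexander dual of the independence complex of H satisfies h(Ind(H)^∨) = |V| − i(H). -/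
/-- The independence complex `Ind(H)` of the hypergraph with edge set `E`: its faces
are the independent sets. -/
def hypIndComplex {V : Type*} (E : Set (Set V)) : Set (Set V) :=
  {S | HIndep E S}

/-- The Helly number `h(Δ)`: the maximum size of a minimal non-face of `Δ`. -/
noncomputable def hellyNum {V : Type*} (Δ : Set (Set V)) : ℕ :=
  sSup {n | ∃ K : Set V, K ∉ Δ ∧ (∀ K' ⊂ K, K' ∈ Δ) ∧ K.ncard = n}

/-- The independent domination number `i(H)` of the hypergraph with edge set `E`:
the least size of a maximal independent set. -/
noncomputable def hypIndepDomNum {V : Type*} (E : Set (Set V)) : ℕ :=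
  sInf {n | ∃ S : Set V,
    (HIndep E S ∧ ∀ T : Set V, HIndep E T → S ⊆ T → S = T) ∧ S.ncard = n}

/-- The minimal non-faces of the Alexander dual of the independence complex are the complements
of the maximal independent sets. -/
theorem minimal_nonface_alexDual_iff {V : Type*} (E : Set (Set V)) (K : Set V) :
    (K ∉ alexDual (hypIndComplex E) ∧ ∀ K' ⊂ K, K' ∈ alexDual (hypIndComplex E)) ↔
      HIndep E Kᶜ ∧ ∀ T : Set V, HIndep E T → Kᶜ ⊆ T → Kᶜ = T := by
  simp only [alexDual, hypIndComplex, Set.mem_ofPred_eq, not_not]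
  refine and_congr_right fun _ => ⟨fun h T hT hKT => ?_, fun h K' hK' hind => ?_⟩
  · by_contra hne
    refine h Tᶜ ?_ (by rwa [compl_compl])
    exact compl_lt_compl_iff_lt.1 (by simpa only [compl_compl] using hKT.ssubset_of_ne hne)
  · exact hK'.ne (compl_injective (h _ hind (Set.compl_subset_compl.2 hK'.subset))).symm

/-- A finite hypergraph without an empty edge has a maximal independent set. -/
theorem exists_maximal_hIndep {V : Type*} [Finite V] (E : Set (Set V)) (hE : ∅ ∉ E) :
    ∃ S : Set V, HIndep E S ∧ ∀ T : Set V, HIndep E T → S ⊆ T → S = T := by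
  have hempty : HIndep E ∅ := fun e he hsub => hE (Set.subset_empty_iff.1 hsub ▸ he)
  obtain ⟨S, hS⟩ := (Set.toFinite {S : Set V | HIndep E S}).exists_maximal ⟨∅, hempty⟩
  exact ⟨S, hS.prop, fun T hT hST => hS.eq_of_subset hT hST⟩

/-- For every simple hypergraph `H` on a finite vertex set `V` (each edge has at least
two vertices, no edge contains another) with at least one edge,
`h(Ind(H)^∨) = |V| − i(H)`. -/
theorem stmt14 {V : Type*} [Fintype V] (E : Set (Set V))
    (hcard : ∀ e ∈ E, 2 ≤ e.ncard)
    (hanti : ∀ e ∈ E, ∀ f ∈ E, e ⊆ f → e = f)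
    (hne : E.Nonempty) :
    hellyNum (alexDual (hypIndComplex E)) = Fintype.card V - hypIndepDomNum E := by
  have hE : ∅ ∉ E := fun h => by simpa using hcard ∅ h
  have hadd (S : Set V) : S.ncard + Sᶜ.ncard = Fintype.card V := by
    rw [Set.ncard_add_ncard_compl, Nat.card_eq_fintype_card]
  obtain ⟨S₀, hS₀⟩ := exists_maximal_hIndep E hE
  obtain ⟨S, hS, hSi⟩ := Nat.sInf_mem (s := {n | ∃ S : Set V,
    (HIndep E S ∧ ∀ T : Set V, HIndep E T → S ⊆ T → S = T) ∧ S.ncard = n}) ⟨_, S₀, hS₀, rfl⟩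
  change S.ncard = hypIndepDomNum E at hSi
  refine IsGreatest.csSup_eq ⟨?_, ?_⟩
  · have hK := (minimal_nonface_alexDual_iff E Sᶜ).2 (by rwa [compl_compl])
    exact ⟨Sᶜ, hK.1, hK.2, by have := hadd S; omega⟩
  · rintro n ⟨K, hK, hmin, rfl⟩
    have hle : hypIndepDomNum E ≤ Kᶜ.ncard :=
      Nat.sInf_le ⟨Kᶜ, (minimal_nonface_alexDual_iff E K).1 ⟨hK, hmin⟩, rfl⟩
    have := hadd K
    omega
end
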